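/- Let U be a free (non-principal) ultrafilter on ℕ, identified with the subset χ(U) = {1_A : A ∈ U} of Ω = {0,1}^ℕ, and let λ be the infinite product on Ω of the fair Bernoulli measure (½)(δ₀ + δ₁) on {0,1}. Then χ(U) is not λ-measurable: it does not belong to the completion of the Borel σ-algebra of Ω with respect to λ; in particular it is not a Borel subset of Ω. -/

import Mathlib

open Filter MeasureTheory

/-- `χ(U) = {1_A : A ∈ U} ⊆ Ω = {0,1}^ℕ`, realized as `ℕ → Bool`. -/
def chiF (F : Filter ℕ) : Set (ℕ → Bool) := {ω | {n | ω n = true} ∈ F}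

/-- The cylinder prescribed by `f` on `s`. -/
def cylF (s : Finset ℕ) (f : ℕ → Bool) : Set (ℕ → Bool) := {ω | ∀ n ∈ s, ω n = f n}

theorem measurableSet_cylF (s : Finset ℕ) (f : ℕ → Bool) : MeasurableSet (cylF s f) := by
  have : cylF s f = ⋂ n ∈ s, (fun ω : ℕ → Bool => ω n) ⁻¹' {f n} := by
    ext ω; simp [cylF]
  rw [this]
  exact Finset.measurableSet_biInter s fun n _ =>
    (measurable_pi_apply n) (measurableSet_singleton _)

/-- The family of all cylinders. -/
def cylFam : Set (Set (ℕ → Bool)) := {C | ∃ s f, C = cylF s f}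

theorem generate_cylFam : (MeasurableSpace.pi : MeasurableSpace (ℕ → Bool)) =
    MeasurableSpace.generateFrom cylFam := by
  apply le_antisymm
  · refine iSup_le fun n => ?_
    rw [← measurable_iff_comap_le]
    refine @measurable_to_countable' _ _ _ _ (MeasurableSpace.generateFrom cylFam) _ fun b => ?_
    apply MeasurableSpace.measurableSet_generateFrom
    refine ⟨{n}, fun _ => b, ?_⟩
    ext ω; simp [cylF]
  · apply MeasurableSpace.generateFrom_le
    rintro _ ⟨s, f, rfl⟩
    exact measurableSet_cylF s f

theorem isPiSystem_cylFam : IsPiSystem cylFam := by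
  rintro _ ⟨s, f, rfl⟩ _ ⟨t, g, rfl⟩ ⟨x, hx1, hx2⟩
  refine ⟨s ∪ t, x, ?_⟩
  ext ω
  simp only [cylF, Set.mem_inter_iff, Set.mem_ofPred_eq, Finset.mem_union] at *
  constructor
  · rintro ⟨h1, h2⟩ n (hn | hn)
    · rw [h1 n hn, hx1 n hn]
    · rw [h2 n hn, hx2 n hn]
  · intro h
    exact ⟨fun n hn => by rw [h n (Or.inl hn), hx1 n hn],
      fun n hn => by rw [h n (Or.inr hn), hx2 n hn]⟩

theorem ext_cylF (μ ν : Measure (ℕ → Bool)) [IsFiniteMeasure μ]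
    (h : ∀ s f, μ (cylF s f) = ν (cylF s f)) : μ = ν := by
  refine ext_of_generate_finite cylFam generate_cylFam isPiSystem_cylFam ?_ ?_
  · rintro _ ⟨s, f, rfl⟩
    exact h s f
  · have := h ∅ (fun _ => true)
    simpa [cylF] using this

/-- Coordinatewise xor with `g`. -/
def flipF (g ω : ℕ → Bool) : ℕ → Bool := fun n => xor (ω n) (g n)

theorem flipF_preimage_cylF (g : ℕ → Bool) (s : Finset ℕ) (f : ℕ → Bool) :
    flipF g ⁻¹' cylF s f = cylF s (flipF g f) := by
  ext ω
  simp only [cylF, flipF, Set.mem_preimage, Set.mem_ofPred_eq]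
  refine forall₂_congr fun n _ => ?_
  cases ω n <;> cases g n <;> cases f n <;> simp

theorem measurable_flipF (g : ℕ → Bool) : Measurable (flipF g) :=
  measurable_pi_lambda _ fun n =>
    (measurable_from_top (f := fun b : Bool => xor b (g n))).comp (measurable_pi_apply n)

theorem mp_flipF (lam : Measure (ℕ → Bool)) [IsProbabilityMeasure lam]
    (hlam : ∀ s f, lam (cylF s f) = (1 / 2 : ENNReal) ^ s.card) (g : ℕ → Bool) :
    MeasurePreserving (flipF g) lam lam := by
  refine ⟨measurable_flipF g, ?_⟩
  have : IsProbabilityMeasure (lam.map (flipF g)) :=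
    Measure.isProbabilityMeasure_map (measurable_flipF g).aemeasurable
  apply ext_cylF
  intro s f
  rw [Measure.map_apply (measurable_flipF g) (measurableSet_cylF s f), flipF_preimage_cylF,
    hlam, hlam]

/-- If `A` is null measurable and invariant under flipping one coordinate, it is
independent from cylinders. -/
theorem indep_cylF (lam : Measure (ℕ → Bool)) [IsProbabilityMeasure lam]
    (hlam : ∀ s f, lam (cylF s f) = (1 / 2 : ENNReal) ^ s.card)
    (A : Set (ℕ → Bool)) (hA : NullMeasurableSet A lam)
    (hinv : ∀ a : ℕ, flipF (fun n => decide (n = a)) ⁻¹' A = A) (s : Finset ℕ) :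
    ∀ f, lam (cylF s f ∩ A) = lam A * (1 / 2 : ENNReal) ^ s.card := by
  induction s using Finset.induction_on with
  | empty => intro f; simp [cylF]
  | insert a s ha ih =>
    intro f
    set g : ℕ → Bool := fun n => decide (n = a) with hg
    have h1 : lam (cylF (insert a s) (flipF g f) ∩ A) = lam (cylF (insert a s) f ∩ A) := by
      rw [← (mp_flipF lam hlam g).measure_preimage
        ((measurableSet_cylF (insert a s) f).nullMeasurableSet.inter hA),
        Set.preimage_inter, flipF_preimage_cylF, hinv a]
    have h2 : cylF s f ∩ A =
        (cylF (insert a s) f ∩ A) ∪ (cylF (insert a s) (flipF g f) ∩ A) := by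
      have key : cylF s f = cylF (insert a s) f ∪ cylF (insert a s) (flipF g f) := by
        ext ω
        have h3 : ∀ n ∈ s, flipF g f n = f n := by
          intro n hn
          have : n ≠ a := fun h => ha (h ▸ hn)
          simp [flipF, hg, this]
        have h4 : flipF g f a = !f a := by simp [flipF, hg]
        simp only [cylF, Set.mem_ofPred_eq, Set.mem_union, Finset.forall_mem_insert, h4]
        have h5 : (∀ n ∈ s, ω n = flipF g f n) ↔ ∀ n ∈ s, ω n = f n :=
          forall₂_congr fun n hn => by rw [h3 n hn]
        rw [h5]
        cases ω a <;> cases f a <;> simp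
      rw [key, Set.union_inter_distrib_right]
    have h6 : Disjoint (cylF (insert a s) f ∩ A) (cylF (insert a s) (flipF g f) ∩ A) := by
      rw [Set.disjoint_left]
      rintro ω ⟨h, -⟩ ⟨h', -⟩
      have e1 := h a (Finset.mem_insert_self a s)
      have e2 := h' a (Finset.mem_insert_self a s)
      rw [e1] at e2
      simp [flipF, hg] at e2
    have h7 := ih f
    rw [h2, measure_union₀ ((measurableSet_cylF _ _).nullMeasurableSet.inter hA)
      h6.aedisjoint, h1, ← two_mul] at h7
    rw [Finset.card_insert_of_notMem ha, pow_succ, ← mul_assoc, ← h7, mul_comm, ← mul_assoc]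
    simp [ENNReal.inv_mul_cancel]

/-- Let `λ` be the product on `Ω = {0,1}^ℕ` of the fair Bernoulli measure
`½(δ₀ + δ₁)` (characterized as the probability measure giving each cylinder
prescribed on a finite set `s` of coordinates the measure `(1/2)^|s|`).
For a free (non-principal) ultrafilter `U` on `ℕ`, the set `χ(U)` is not
`λ`-measurable, i.e. it does not belong to the `λ`-completion of the Borel
σ-algebra (= the product σ-algebra) of `Ω`; in particular it is not
measurable (Borel). -/
theorem free_ultrafilter_not_measurable (U : Ultrafilter ℕ)
    (hU : ∀ A : Set ℕ, A.Finite → A ∉ U)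
    (lam : Measure (ℕ → Bool)) [IsProbabilityMeasure lam]
    (hlam : ∀ (s : Finset ℕ) (f : ℕ → Bool),
      lam {ω | ∀ n ∈ s, ω n = f n} = (1 / 2 : ENNReal) ^ s.card) :
    ¬ NullMeasurableSet (chiF (U : Filter ℕ)) lam ∧
      ¬ MeasurableSet (chiF (U : Filter ℕ)) := by
  have hlam' : ∀ s f, lam (cylF s f) = (1 / 2 : ENNReal) ^ s.card := hlam
  suffices h : ¬ NullMeasurableSet (chiF (U : Filter ℕ)) lam from
    ⟨h, fun hm => h hm.nullMeasurableSet⟩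
  intro hA
  set A := chiF (U : Filter ℕ) with hAdef
  have hinv : ∀ a : ℕ, flipF (fun n => decide (n = a)) ⁻¹' A = A := by
    intro a
    ext ω
    simp only [hAdef, chiF, Set.mem_preimage, Set.mem_ofPred_eq]
    have hmem : ({a} : Set ℕ)ᶜ ∈ (U : Filter ℕ) :=
      Ultrafilter.compl_mem_iff_notMem.2 (hU {a} (Set.finite_singleton a))
    apply Filter.congr_sets
    filter_upwards [hmem] with n hn
    have : n ≠ a := hn
    simp [flipF, this]
  have hcompl : flipF (fun _ => true) ⁻¹' A = Aᶜ := by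
    ext ω
    simp only [hAdef, chiF, Set.mem_preimage, Set.mem_ofPred_eq, Set.mem_compl_iff]
    rw [Ultrafilter.mem_coe, Ultrafilter.mem_coe, ← Ultrafilter.compl_mem_iff_notMem]
    have : {n | flipF (fun _ => true) ω n = true} = {n | ω n = true}ᶜ := by
      ext n; simp [flipF]
    rw [this]
  have e1 : lam Aᶜ = lam A := by
    rw [← hcompl, (mp_flipF lam hlam' _).measure_preimage hA]
  have e2 : lam.restrict A = lam A • lam := by
    apply ext_cylF
    intro s f
    rw [Measure.restrict_apply (measurableSet_cylF s f), indep_cylF lam hlam' A hA hinv,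
      Measure.smul_apply, hlam', smul_eq_mul]
  have e3 : lam.restrict A Aᶜ = 0 := by
    rw [Measure.restrict_apply₀' hA]; simp
  rw [e2, Measure.smul_apply, e1, smul_eq_mul, mul_self_eq_zero] at e3
  have e4 := measure_add_measure_compl₀ hA
  rw [e1, e3] at e4
  simp at e4
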